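/- Let a be a (1,∞)-atom supported in a parabolic ball Q contained in X = (0,∞) × ℝⁿ, and define u(t,x) = ∫_0^t ∫_{ℝⁿ} p_{t−s}(x−y) a(s,y) dy ds for (t,x) ∈ X (an absolutely convergent integral). Suppose g ∈ L¹(X) is such that for almost every t > 0 the distributional Laplacian in x of u(t,·) equals g(t,·). Then for almost every t > 0 one has ∫_{ℝⁿ} g(t,x) dx = 0; in particular ∫∫_X g(t,x) dx dt = 0. -/

import Mathlib

open MeasureTheory Metric Filter Set

noncomputable section

/-- The Gauss–Weierstrass heat kernel `p_t(z) = (4πt)^{−n/2} exp(−|z|²/(4t))` on `ℝⁿ`. -/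
def heatKernel (n : ℕ) (t : ℝ) (z : EuclideanSpace ℝ (Fin n)) : ℝ :=
  (4 * Real.pi * t) ^ (-(n : ℝ) / 2) * Real.exp (-‖z‖ ^ 2 / (4 * t))

/-- The parabolic quasi-distance on `N = ℝ × ℝⁿ`. -/
def pdist {n : ℕ} (p q : ℝ × EuclideanSpace ℝ (Fin n)) : ℝ :=
  max (Real.sqrt |p.1 - q.1|) (dist p.2 q.2)

/-- The open parabolic ball in `N = ℝ × ℝⁿ`. -/
def pball {n : ℕ} (c : ℝ × EuclideanSpace ℝ (Fin n)) (r : ℝ) :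
    Set (ℝ × EuclideanSpace ℝ (Fin n)) :=
  {p | pdist p c < r}

/-- The half-space `X = (0,∞) × ℝⁿ`. -/
def Xset (n : ℕ) : Set (ℝ × EuclideanSpace ℝ (Fin n)) := {p | 0 < p.1}

/-- A `(1,∞)`-atom supported in the parabolic ball `pball c r ⊆ X`: support in the ball,
mean value zero, and `‖a‖_∞ ≤ ν(Q)^{−1}`. -/
def IsAtom1Inf (n : ℕ) (a : ℝ × EuclideanSpace ℝ (Fin n) → ℝ)
    (c : ℝ × EuclideanSpace ℝ (Fin n)) (r : ℝ) : Prop :=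
  0 < r ∧ Function.support a ⊆ pball c r ∧ pball c r ⊆ Xset n ∧
    Integrable a volume ∧ (∫ p, a p) = 0 ∧
    eLpNorm a ⊤ volume ≤ (volume (pball c r))⁻¹

/-- The Laplacian of `φ : ℝⁿ → ℝ` as the sum of its second partial derivatives. -/
def lapl {n : ℕ} (φ : EuclideanSpace ℝ (Fin n) → ℝ) (x : EuclideanSpace ℝ (Fin n)) : ℝ :=
  ∑ i : Fin n,
    iteratedFDeriv ℝ 2 φ x ![EuclideanSpace.single i 1, EuclideanSpace.single i 1]

theorem measurable_heatKernel (n : ℕ) :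
    Measurable fun p : ℝ × EuclideanSpace ℝ (Fin n) => heatKernel n p.1 p.2 := by
  unfold heatKernel
  fun_prop

theorem integrable_heatKernel_integral_eq_one (n : ℕ) {t : ℝ} (ht : 0 < t) :
    Integrable (heatKernel n t) ∧ ∫ z, heatKernel n t z = 1 := by
  have hb : (0 : ℝ) < 1 / (4 * t) := by positivity
  have hfun : heatKernel n t = fun z => (4 * Real.pi * t) ^ (-(n : ℝ) / 2) *
      Real.exp (-(1 / (4 * t)) * ‖z‖ ^ 2) := by
    funext z
    unfold heatKernel
    congr 2
    ring
  have hval : ∫ z, heatKernel n t z = 1 := by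
    rw [hfun, integral_const_mul, GaussianFourier.integral_rexp_neg_mul_sq_norm hb,
      finrank_euclideanSpace_fin]
    have h4 : Real.pi / (1 / (4 * t)) = 4 * Real.pi * t := by
      field_simp
    rw [h4, ← Real.rpow_add (by positivity), neg_div, neg_add_cancel, Real.rpow_zero]
  refine ⟨?_, hval⟩
  by_contra h
  rw [integral_undef h] at hval
  exact zero_ne_one hval

theorem heatKernel_nonneg (n : ℕ) {t : ℝ} (ht : 0 ≤ t) (z : EuclideanSpace ℝ (Fin n)) :
    0 ≤ heatKernel n t z := by
  unfold heatKernel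
  positivity

/-- The heat potential of an integrable source is integrable in space at every time. -/
theorem integrable_heatPotential {n : ℕ} {a : ℝ × EuclideanSpace ℝ (Fin n) → ℝ}
    (ha : Integrable a) (t : ℝ) :
    Integrable fun x : EuclideanSpace ℝ (Fin n) =>
      ∫ q in Set.Ioo (0 : ℝ) t ×ˢ (Set.univ : Set (EuclideanSpace ℝ (Fin n))),
        heatKernel n (t - q.1) (x - q.2) * a q := by
  set S := Set.Ioo (0 : ℝ) t ×ˢ (Set.univ : Set (EuclideanSpace ℝ (Fin n)))
  have hS : MeasurableSet S := measurableSet_Ioo.prod MeasurableSet.univ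
  have hmeas : AEStronglyMeasurable
      (fun z : EuclideanSpace ℝ (Fin n) × (ℝ × EuclideanSpace ℝ (Fin n)) =>
        heatKernel n (t - z.2.1) (z.1 - z.2.2) * a z.2)
      (volume.prod (volume.restrict S)) := by
    refine AEStronglyMeasurable.mul ?_ ha.aestronglyMeasurable.restrict.comp_snd
    exact ((measurable_heatKernel n).comp
      (f := fun z : EuclideanSpace ℝ (Fin n) × (ℝ × EuclideanSpace ℝ (Fin n)) =>
        (t - z.2.1, z.1 - z.2.2)) (by fun_prop)).aestronglyMeasurable
  have hint : Integrable
      (fun z : EuclideanSpace ℝ (Fin n) × (ℝ × EuclideanSpace ℝ (Fin n)) =>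
        heatKernel n (t - z.2.1) (z.1 - z.2.2) * a z.2)
      (volume.prod (volume.restrict S)) := by
    rw [integrable_prod_iff' hmeas]
    constructor
    · filter_upwards [ae_restrict_mem hS] with q hq
      have hq' : 0 < t - q.1 := sub_pos.2 hq.1.2
      exact ((integrable_heatKernel_integral_eq_one n hq').1.comp_sub_right q.2).mul_const _
    · refine ha.norm.restrict.congr ?_
      filter_upwards [ae_restrict_mem hS] with q hq
      have hq' : 0 < t - q.1 := sub_pos.2 hq.1.2
      simp only [norm_mul, Real.norm_of_nonneg (heatKernel_nonneg n hq'.le _)]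
      rw [integral_mul_const, integral_sub_right_eq_self (heatKernel n (t - q.1)) q.2,
        (integrable_heatKernel_integral_eq_one n hq').2, one_mul]
  exact hint.integral_prod_left

theorem exists_abs_lapl_comp_smul_le {n : ℕ} {χ : EuclideanSpace ℝ (Fin n) → ℝ}
    (hχ : ContDiff ℝ (⊤ : ℕ∞) χ) (hc : HasCompactSupport χ) :
    ∃ C : ℝ, ∀ (ε : ℝ) (x : EuclideanSpace ℝ (Fin n)),
      |lapl (fun y => χ (ε • y)) x| ≤ C * ε ^ 2 := by
  have hχ2 : ContDiff ℝ 2 χ := contDiff_infty.1 hχ 2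
  obtain ⟨C, hC⟩ := (hc.iteratedFDeriv (𝕜 := ℝ) 2).exists_bound_of_continuous
    (hχ2.continuous_iteratedFDeriv (m := 2) le_rfl)
  refine ⟨n * C, fun ε x => ?_⟩
  have hderiv := (ε • ContinuousLinearMap.id ℝ (EuclideanSpace ℝ (Fin n))).iteratedFDeriv_comp_right
    hχ2 x (i := 2) le_rfl
  have hterm : ∀ i : Fin n, |iteratedFDeriv ℝ 2 (fun y => χ (ε • y)) x
      ![EuclideanSpace.single i 1, EuclideanSpace.single i 1]| ≤ C * ε ^ 2 := by
    intro i
    have hcomp : (fun y => χ (ε • y)) =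
        χ ∘ (ε • ContinuousLinearMap.id ℝ (EuclideanSpace ℝ (Fin n))) := by
      ext y
      simp
    rw [hcomp, hderiv, ContinuousMultilinearMap.compContinuousLinearMap_apply, ← Real.norm_eq_abs]
    refine (ContinuousMultilinearMap.le_opNorm _ _).trans ?_
    simp only [Fin.prod_univ_two]
    refine (mul_le_mul_of_nonneg_right (hC _) (by positivity)).trans_eq ?_
    simp [norm_smul, sq]
  calc |lapl (fun y => χ (ε • y)) x|
      ≤ ∑ i : Fin n, |iteratedFDeriv ℝ 2 (fun y => χ (ε • y)) x
          ![EuclideanSpace.single i 1, EuclideanSpace.single i 1]| :=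
        Finset.abs_sum_le_sum_abs _ _
    _ ≤ ∑ _i : Fin n, C * ε ^ 2 := Finset.sum_le_sum fun i _ => hterm i
    _ = n * C * ε ^ 2 := by simp [mul_assoc]

/-- An integrable distributional Laplacian of an integrable function has integral zero. -/
theorem integral_eq_zero_of_distributional_lapl {n : ℕ} {v h : EuclideanSpace ℝ (Fin n) → ℝ}
    (hv : Integrable v) (hh : Integrable h)
    (hlap : ∀ φ : EuclideanSpace ℝ (Fin n) → ℝ, ContDiff ℝ (⊤ : ℕ∞) φ → HasCompactSupport φ →
      (∫ x, v x * lapl φ x) = ∫ x, h x * φ x) :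
    ∫ x, h x = 0 := by
  let χ : ContDiffBump (0 : EuclideanSpace ℝ (Fin n)) := ⟨1, 2, one_pos, one_lt_two⟩
  obtain ⟨C, hC⟩ := exists_abs_lapl_comp_smul_le χ.contDiff χ.hasCompactSupport
  let ε : ℕ → ℝ := fun k => 1 / ((k : ℝ) + 1)
  have hεpos : ∀ k, 0 < ε k := fun k => by positivity
  have hε : Tendsto ε atTop (nhds 0) := tendsto_one_div_add_atTop_nhds_zero_nat
  have hright : Tendsto (fun k => ∫ x, h x * χ (ε k • x)) atTop (nhds (∫ x, h x)) := by
    refine tendsto_integral_of_dominated_convergence (fun x => ‖h x‖) (fun k => ?_) hh.norm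
      (fun k => .of_forall fun x => ?_) (.of_forall fun x => ?_)
    · exact hh.aestronglyMeasurable.mul
        (χ.continuous.comp (continuous_const_smul (ε k))).aestronglyMeasurable
    · rw [norm_mul, Real.norm_of_nonneg χ.nonneg]
      exact mul_le_of_le_one_right (norm_nonneg _) χ.le_one
    · have hx : Tendsto (fun k => ε k • x) atTop (nhds 0) := by
        simpa using hε.smul_const x
      refine tendsto_const_nhds.congr' ?_
      filter_upwards [hx.eventually (closedBall_mem_nhds 0 one_pos)] with k hk
      rw [χ.one_of_mem_closedBall hk, mul_one]
  have hleft : Tendsto (fun k => ∫ x, h x * χ (ε k • x)) atTop (nhds 0) := by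
    have hbound : Tendsto (fun k => (∫ x, ‖v x‖) * (C * ε k ^ 2)) atTop (nhds 0) := by
      simpa using ((hε.pow 2).const_mul C).const_mul (∫ x, ‖v x‖)
    refine squeeze_zero_norm (fun k => ?_) hbound
    have hsmooth : ContDiff ℝ (⊤ : ℕ∞) fun x => χ (ε k • x) :=
      χ.contDiff.comp (contDiff_const_smul (ε k))
    have hcompact : HasCompactSupport fun x => χ (ε k • x) :=
      χ.hasCompactSupport.comp_smul (hεpos k).ne'
    rw [← hlap _ hsmooth hcompact, ← integral_mul_const]
    refine norm_integral_le_of_norm_le (hv.norm.mul_const _) (.of_forall fun x => ?_)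
    rw [norm_mul]
    exact mul_le_mul_of_nonneg_left (hC (ε k) x) (norm_nonneg _)
  exact tendsto_nhds_unique hright hleft

/-- for a `(1,∞)`-atom `a` supported in a parabolic ball `Q ⊆ X`, let
`u(t,x) = ∫_0^t ∫ p_{t−s}(x−y) a(s,y) dy ds`. If `g ∈ L¹(X)` is such that for a.e. `t > 0`
the distributional Laplacian in `x` of `u(t,·)` equals `g(t,·)`, then for a.e. `t > 0` one
has `∫ g(t,x) dx = 0`; in particular `∫∫_X g = 0`. -/
theorem stmt16 (n : ℕ) (hn : 1 ≤ n)
    (a : ℝ × EuclideanSpace ℝ (Fin n) → ℝ)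
    (c : ℝ × EuclideanSpace ℝ (Fin n)) (r : ℝ)
    (ha : IsAtom1Inf n a c r)
    (u : ℝ → EuclideanSpace ℝ (Fin n) → ℝ)
    (hu : ∀ (t : ℝ) (x : EuclideanSpace ℝ (Fin n)),
      u t x = ∫ q in Set.Ioo (0 : ℝ) t ×ˢ (Set.univ : Set (EuclideanSpace ℝ (Fin n))),
        heatKernel n (t - q.1) (x - q.2) * a q)
    (g : ℝ × EuclideanSpace ℝ (Fin n) → ℝ)
    (hg : IntegrableOn g (Xset n) volume)
    (hlap : ∀ᵐ t ∂(volume.restrict (Set.Ioi (0 : ℝ))),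
      ∀ φ : EuclideanSpace ℝ (Fin n) → ℝ, ContDiff ℝ (⊤ : ℕ∞) φ → HasCompactSupport φ →
        (∫ x, u t x * lapl φ x) = ∫ x, g (t, x) * φ x) :
    (∀ᵐ t ∂(volume.restrict (Set.Ioi (0 : ℝ))), (∫ x, g (t, x)) = 0) ∧
    (∫ q in Xset n, g q) = 0 := by
  have hX : volume.restrict (Xset n) = (volume.restrict (Set.Ioi (0 : ℝ))).prod
      (volume : Measure (EuclideanSpace ℝ (Fin n))) := by
    have hset : Xset n = Set.Ioi (0 : ℝ) ×ˢ Set.univ := by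
      ext p
      simp [Xset]
    rw [hset, Measure.volume_eq_prod, ← Measure.prod_restrict, Measure.restrict_univ]
  have hg' : Integrable g ((volume.restrict (Set.Ioi (0 : ℝ))).prod volume) := by
    rwa [IntegrableOn, hX] at hg
  have hzero : ∀ᵐ t ∂(volume.restrict (Set.Ioi (0 : ℝ))), (∫ x, g (t, x)) = 0 := by
    filter_upwards [hlap, hg'.prod_right_ae] with t ht hgt
    refine integral_eq_zero_of_distributional_lapl ?_ hgt ht
    simpa only [← hu] using integrable_heatPotential ha.2.2.2.1 t
  refine ⟨hzero, ?_⟩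
  rw [hX, integral_prod _ hg', integral_congr_ae hzero, integral_zero]
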